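/- There exist a field K, finite-dimensional K-algebras S and R, a finite-dimensional cotilting S-R-bimodule C for which no S-R-bimodule structure exists on an injective envelope of the left S-module C containing C as a sub-bimodule, together with a hereditary finite-dimensional K-algebra R*, a surjective K-algebra homomorphism F: R* → R whose kernel is a 1-dimensional K-vector space, and an S-R*-bimodule U containing C (where C is regarded as an S-R*-bimodule by restriction of the right action along F) as a sub-bimodule, such that the underlying left S-module of U is an injective envelope of the left S-module C. -/

import Mathlib

open CategoryTheory

noncomputable section

/-! ### Generalities -/

section Generalities

variable (A : Type) [Ring A]

/-- `Ext^n_A(M, N) = 0`. -/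
def ExtVanish (M N : ModuleCat.{0} A) (n : ℕ) : Prop :=
  Subsingleton (((Ext ℤ (ModuleCat.{0} A) n).obj (Opposite.op M)).obj N)

/-- `N ∈ Prod M`: `N` is a direct summand of a direct product of copies of `M`. -/
def InProd (M N : ModuleCat.{0} A) : Prop :=
  ∃ (ι : Type) (s : N ⟶ ModuleCat.of A (ι → M)) (r : ModuleCat.of A (ι → M) ⟶ N),
    s ≫ r = 𝟙 N

/-- `Q` is an injective cogenerator of the category of left `A`-modules. -/
def IsInjectiveCogenerator (Q : ModuleCat.{0} A) : Prop :=
  Injective Q ∧ ∀ X : ModuleCat.{0} A, ∃ (ι : Type) (f : X ⟶ ModuleCat.of A (ι → Q)),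
    Function.Injective f

/-- `C` is a classical cotilting left `A`-module: (i) `C` has injective dimension at most `1`;
(ii) `Ext¹(C^I, C) = 0` for every direct product of copies of `C`; (iii) there is a short
exact sequence `0 → C' → C'' → Q → 0` with `Q` an injective cogenerator and
`C', C'' ∈ Prod C`. -/
def IsClassicalCotilting (C : Type) [AddCommGroup C] [Module A C] : Prop :=
  (∀ (X : ModuleCat.{0} A) (i : ℕ), 1 < i → ExtVanish A X (ModuleCat.of A C) i) ∧
  (∀ ι : Type, ExtVanish A (ModuleCat.of A (ι → C)) (ModuleCat.of A C) 1) ∧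
  (∃ (Q C' C'' : ModuleCat.{0} A) (f : C' ⟶ C'') (g : C'' ⟶ Q),
    IsInjectiveCogenerator A Q ∧ InProd A (ModuleCat.of A C) C' ∧
    InProd A (ModuleCat.of A C) C'' ∧
    Function.Injective f ∧ Function.Surjective g ∧ Function.Exact f g)

/-- `E`, together with the embedding `j`, is an injective envelope of `C`:
`E` is injective, `j` is injective, and the image of `j` is essential in `E`. -/
def IsInjEnvelope (C E : Type) [AddCommGroup C] [Module A C]
    [AddCommGroup E] [Module A E] (j : C →ₗ[A] E) : Prop :=
  Module.Injective A E ∧ Function.Injective j ∧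
    ∀ N : Submodule A E, N ≠ ⊥ → N ⊓ LinearMap.range j ≠ ⊥

variable (B : Type) [Ring B]

/-- an `A`-linear endomorphism commuting with a second (commuting) `B`-action, i.e. an
endomorphism of bimodules. -/
def CommutesWith (M : Type) [AddCommGroup M] [Module A M] [Module B M]
    (p : M →ₗ[A] M) : Prop :=
  ∀ (b : B) (x : M), p (b • x) = b • p x

/-- a bimodule (with commuting `A`- and `B`-actions) is indecomposable iff it is nonzero and
its only idempotent bimodule endomorphisms are `0` and the identity. -/
def BimodIndecomposable (M : Type) [AddCommGroup M] [Module A M] [Module B M] : Prop :=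
  Nontrivial M ∧ ∀ p : M →ₗ[A] M, CommutesWith A B M p → p ∘ₗ p = p →
    p = 0 ∨ p = LinearMap.id

/-- a bimodule is a direct sum of two nonzero sub-bimodules iff it admits a nontrivial
idempotent bimodule endomorphism. -/
def BimodDecomposable (M : Type) [AddCommGroup M] [Module A M] [Module B M] : Prop :=
  ∃ p : M →ₗ[A] M, CommutesWith A B M p ∧ p ∘ₗ p = p ∧ p ≠ 0 ∧ p ≠ LinearMap.id

end Generalities

/-- `C`, an `S`-`R`-bimodule over a field `K` (both algebras and the bimodule being
finite-dimensional over `K`), is a cotilting bimodule: it is faithfully balanced and is a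
classical cotilting module on both sides. -/
def IsCotiltingBimodule (K S R C : Type) [Field K] [Ring S] [Algebra K S] [Ring R]
    [Algebra K R] [AddCommGroup C] [Module S C] [Module Rᵐᵒᵖ C] [SMulCommClass S Rᵐᵒᵖ C] :
    Prop :=
  haveI : SMulCommClass Rᵐᵒᵖ S C := SMulCommClass.symm S Rᵐᵒᵖ C
  Function.Bijective (Module.toModuleEnd Rᵐᵒᵖ C : S →+* Module.End Rᵐᵒᵖ C) ∧
  Function.Bijective (Module.toModuleEnd S C : Rᵐᵒᵖ →+* Module.End S C) ∧
  IsClassicalCotilting S C ∧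
  IsClassicalCotilting Rᵐᵒᵖ C

/-- The left `S`-module `E`, containing the `S`-`R`-bimodule `C` via `j`, admits a right
`R`-module structure making it an `S`-`R`-bimodule containing `C` as a sub-bimodule. -/
def HasRightExtension (S R : Type) [Ring S] [Ring R] (C E : Type) [AddCommGroup C]
    [Module S C] [Module Rᵐᵒᵖ C] [AddCommGroup E] [Module S E] (j : C →ₗ[S] E) : Prop :=
  ∃ m : Module Rᵐᵒᵖ E,
    (by letI := m; exact
      (∀ (s : S) (r : Rᵐᵒᵖ) (x : E), s • r • x = r • s • x) ∧
      (∀ (r : Rᵐᵒᵖ) (c : C), j (r • c) = r • j c) : Prop)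

/-- A ring is left hereditary if every left ideal is projective. -/
def IsLeftHereditary (A : Type) [Ring A] : Prop :=
  ∀ I : Ideal A, Module.Projective A I

/-! ### Statement 14: the bad case repaired by a hereditary concealed ring `R*` -/

/-- The data asserted to exist in Statement 14. -/
structure HereditaryConcealedExample where
  K : Type
  [fK : Field K]
  S : Type
  [rS : Ring S]
  [aS : Algebra K S]
  finS : FiniteDimensional K S
  R : Type
  [rR : Ring R]
  [aR : Algebra K R]
  finR : FiniteDimensional K R
  C : Type
  [abC : AddCommGroup C]
  [mSC : Module S C]
  [mRC : Module Rᵐᵒᵖ C]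
  [sccC : SMulCommClass S Rᵐᵒᵖ C]
  [mKC : Module K C]
  [towSC : IsScalarTower K S C]
  [towRC : IsScalarTower K Rᵐᵒᵖ C]
  finC : FiniteDimensional K C
  cotilting : IsCotiltingBimodule K S R C
  /-- there is NO bimodule `D ⊇ C` whose underlying left `S`-module is an injective
  envelope of the left `S`-module `C` -/
  noLeftExt : ∀ (E : Type) [AddCommGroup E] [Module S E] (j : C →ₗ[S] E),
    IsInjEnvelope S C E j → ¬ HasRightExtension S R C E j
  -- the concealed ring `R*` and the epimorphism `F : R* → R`
  Rstar : Type
  [rRstar : Ring Rstar]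
  [aRstar : Algebra K Rstar]
  finRstar : FiniteDimensional K Rstar
  F : Rstar →ₐ[K] R
  surjF : Function.Surjective F
  hered : IsLeftHereditary Rstar
  kerF_dim : Module.finrank K ((RingHom.ker (F : Rstar →+* R)).restrictScalars K) = 1
  -- the `S`-`R*`-bimodule `U`, whose underlying left `S`-module is an injective envelope
  -- of `C`, containing `C` (with its right `R*`-action restricted along `F`)
  U : Type
  [abU : AddCommGroup U]
  [mSU : Module S U]
  [mRstarU : Module Rstarᵐᵒᵖ U]
  [sccU : SMulCommClass S Rstarᵐᵒᵖ U]
  j : C →ₗ[S] U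
  envU : IsInjEnvelope S C U j
  j_right_linear : ∀ (r : Rstar) (c : C),
    j (MulOpposite.op (F r) • c) = MulOpposite.op r • j c

/-! ### Vanishing of `Ext` from an injective copresentation -/

section ExtVanishing

variable {A : Type} [Ring A]

lemma extVanish_succ_of_cocycle {M N : ModuleCat.{0} A} {n : ℕ} (P : ProjectiveResolution M)
    (h : ∀ f : P.complex.X (n + 1) ⟶ N, P.complex.d (n + 2) (n + 1) ≫ f = 0 →
      ∃ g : P.complex.X n ⟶ N, P.complex.d (n + 1) n ≫ g = f) :
    ExtVanish A M N (n + 1) := by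
  refine ModuleCat.subsingleton_of_isZero (Limits.IsZero.of_iso ?_ (P.isoExt (n + 1) N))
  rw [← HomologicalComplex.exactAt_iff_isZero_homology,
    HomologicalComplex.exactAt_iff' _ n (n + 1) (n + 2) (by simp) (by simp),
    ShortComplex.moduleCat_exact_iff]
  exact h

/-- If `0 → N → I → J` is exact with `I` injective, then `Ext^(n+1)(M, N)` vanishes as soon as
`n`-cocycles with values in `J` lift to `n`-cocycles with values in `I`. -/
lemma extVanish_succ_of_lift_cocycle {M : ModuleCat.{0} A} {n : ℕ} (P : ProjectiveResolution M)
    (T : ShortComplex (ModuleCat.{0} A)) (hT : T.Exact) [Mono T.f] [Injective T.X₂]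
    (h : ∀ k : P.complex.X n ⟶ T.X₃, P.complex.d (n + 1) n ≫ k = 0 →
      ∃ l : P.complex.X n ⟶ T.X₂, l ≫ T.g = k ∧ P.complex.d (n + 1) n ≫ l = 0) :
    ExtVanish A M T.X₁ (n + 1) := by
  refine extVanish_succ_of_cocycle P fun f hf => ?_
  have hfi : P.complex.d (n + 2) (n + 1) ≫ f ≫ T.f = 0 := by rw [← Category.assoc, hf]; simp
  obtain ⟨g, hg⟩ : ∃ g : P.complex.X n ⟶ T.X₂, P.complex.d (n + 1) n ≫ g = f ≫ T.f :=
    ⟨_, (P.exact_succ n).comp_descToInjective (f ≫ T.f) hfi⟩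
  obtain ⟨l, hl, hl'⟩ := h (g ≫ T.g) (by rw [← Category.assoc, hg]; simp)
  have hgl : (g - l) ≫ T.g = 0 := by simp [hl]
  refine ⟨hT.lift (g - l) hgl, ?_⟩
  rw [← cancel_mono T.f, Category.assoc, hT.lift_f]
  simp [hg, hl']

lemma extVanish_of_one_lt {M : ModuleCat.{0} A} (T : ShortComplex (ModuleCat.{0} A))
    (hT : T.Exact) [Mono T.f] [Epi T.g] [Injective T.X₂] [Injective T.X₃] {i : ℕ} (hi : 1 < i) :
    ExtVanish A M T.X₁ i := by
  obtain ⟨n, rfl⟩ := Nat.exists_eq_add_of_lt hi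
  have P := projectiveResolution M
  rw [show 1 + n + 1 = (n + 1) + 1 by omega]
  refine extVanish_succ_of_lift_cocycle P T hT fun k hk => ?_
  let k' := (P.exact_succ n).descToInjective k hk
  have hk' : P.complex.d (n + 1) n ≫ k' = k := (P.exact_succ n).comp_descToInjective k hk
  refine ⟨P.complex.d (n + 1) n ≫ Projective.factorThru k' T.g, by simp [hk'], by simp⟩

lemma extVanish_one_of_lift {M : ModuleCat.{0} A} (T : ShortComplex (ModuleCat.{0} A))
    (hT : T.Exact) [Mono T.f] [Injective T.X₂]
    (h : ∀ k : M ⟶ T.X₃, ∃ l : M ⟶ T.X₂, l ≫ T.g = k) : ExtVanish A M T.X₁ 1 := by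
  have P := projectiveResolution M
  refine extVanish_succ_of_lift_cocycle (n := 0) P T hT fun k hk => ?_
  replace h : ∀ k : ((ChainComplex.single₀ _).obj M).X 0 ⟶ T.X₃, ∃ l, l ≫ T.g = k := h
  obtain ⟨l, hl⟩ := h (P.exact₀.desc k hk)
  refine ⟨P.π.f 0 ≫ l, ?_, ?_⟩
  · rw [Category.assoc, hl, P.exact₀.g_desc]
  · rw [← Category.assoc, P.complex_d_comp_π_f_zero, Limits.zero_comp]

end ExtVanishing
/-! ### Coinduced injective modules -/

section Coinduced

lemma LinearMap.exists_comp_eq_of_ker_le {K V W V' : Type*} [Field K] [AddCommGroup V]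
    [Module K V] [AddCommGroup W] [Module K W] [AddCommGroup V'] [Module K V']
    (T : V →ₗ[K] W) (f : V →ₗ[K] V') (h : LinearMap.ker T ≤ LinearMap.ker f) :
    ∃ g : W →ₗ[K] V', g ∘ₗ T = f := by
  obtain ⟨r, hr⟩ := ((LinearMap.ker T).liftQ T le_rfl).exists_leftInverse_of_injective
    (Submodule.ker_liftQ_eq_bot _ _ _ le_rfl)
  refine ⟨(LinearMap.ker T).liftQ f h ∘ₗ r, LinearMap.ext fun v => ?_⟩
  have := LinearMap.congr_fun hr (Submodule.Quotient.mk v)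
  simp only [LinearMap.comp_apply, Submodule.liftQ_apply, LinearMap.id_apply] at this
  simp [this]

lemma Module.Injective.prod {A M N : Type} [Ring A] [AddCommGroup M] [Module A M]
    [AddCommGroup N] [Module A N] (hM : Module.Injective A M) (hN : Module.Injective A N) :
    Module.Injective A (M × N) where
  out X Y _ _ _ _ f hf g := by
    obtain ⟨h, hh⟩ := hM.out f hf (LinearMap.fst A M N ∘ₗ g)
    obtain ⟨k, hk⟩ := hN.out f hf (LinearMap.snd A M N ∘ₗ g)
    exact ⟨h.prod k, fun x => Prod.ext (hh x) (hk x)⟩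

variable {K A : Type} [Field K] [Ring A] [Algebra K A]

/-- For an idempotent `e`, the functional `ℓ` exhibits the `A`-module `E` as the
`K`-dual of the right `A`-module `eA`: the functionals `φ` on `A` that factor through left
multiplication by `e` are exactly the functionals `a ↦ ℓ (a • x)`, for unique `x`. -/
structure IsCoinduced (e : A) {E : Type} [AddCommGroup E] [Module K E] [Module A E]
    (ℓ : E →ₗ[K] K) : Prop where
  idem : e * e = e
  apply_smul : ∀ x, ℓ (e • x) = ℓ x
  eq_zero : ∀ x, (∀ a : A, ℓ (a • x) = 0) → x = 0
  exists_eq : ∀ φ : A →ₗ[K] K, (∀ a, φ (e * a) = φ a) → ∃ x, ∀ a, ℓ (a • x) = φ a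

namespace IsCoinduced

variable {e : A} {E : Type} [AddCommGroup E] [Module K E] [Module A E] {ℓ : E →ₗ[K] K}
  {M : Type} [AddCommGroup M] [Module A M]

lemma eq_of_apply_eq (hE : IsCoinduced e ℓ) {x y : E} (h : ∀ a : A, ℓ (a • x) = ℓ (a • y)) :
    x = y :=
  sub_eq_zero.1 <| hE.eq_zero _ fun a => by rw [smul_sub, map_sub, h, sub_self]

lemma hom_ext (hE : IsCoinduced e ℓ) {g h : M →ₗ[A] E} (H : ∀ m, ℓ (g m) = ℓ (h m)) : g = h :=
  LinearMap.ext fun m => hE.eq_of_apply_eq fun a => by rw [← map_smul, ← map_smul, H]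

lemma exists_hom [Module K M] [IsScalarTower K A M] (hE : IsCoinduced e ℓ) (φ : M →ₗ[K] K)
    (hφ : ∀ m, φ (e • m) = φ m) : ∃ h : M →ₗ[A] E, ∀ m, ℓ (h m) = φ m := by
  have key : ∀ m, ∃ x : E, ∀ a : A, ℓ (a • x) = φ (a • m) := fun m =>
    hE.exists_eq (φ ∘ₗ (LinearMap.toSpanSingleton A M m).restrictScalars K) fun a => by
      simp [mul_smul, hφ]
  choose h hh using key
  refine ⟨⟨⟨h, fun m n => hE.eq_of_apply_eq fun a => ?_⟩,
    fun b m => hE.eq_of_apply_eq fun a => ?_⟩, fun m => ?_⟩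
  · simp [hh]
  · simp [hh, smul_smul]
  · simpa using hh m 1

lemma injective [IsScalarTower K A E] (hE : IsCoinduced e ℓ) : Module.Injective A E where
  out X Y _ _ _ _ f hf g := by
    let : Module K X := Module.compHom X (algebraMap K A)
    let : Module K Y := Module.compHom Y (algebraMap K A)
    have : IsScalarTower K A X := .of_algebraMap_smul fun _ _ => rfl
    have : IsScalarTower K A Y := .of_algebraMap_smul fun _ _ => rfl
    obtain ⟨ψ, hψ⟩ := (f.restrictScalars K).exists_comp_eq_of_ker_le (ℓ ∘ₗ g.restrictScalars K)
      (by rw [LinearMap.ker_eq_bot.2 (by exact hf)]; exact bot_le)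
    replace hψ : ∀ x, ψ (f x) = ℓ (g x) := fun x => LinearMap.congr_fun hψ x
    obtain ⟨h, hh⟩ := hE.exists_hom (ψ ∘ₗ DistribSMul.toLinearMap K Y e) fun m => by
      simp [smul_smul, hE.idem]
    refine ⟨h, fun x => hE.eq_of_apply_eq fun a => ?_⟩
    rw [← map_smul, ← map_smul, ← map_smul, hh, LinearMap.comp_apply,
      DistribSMul.toLinearMap_apply, ← map_smul, hψ, map_smul, hE.apply_smul]

/-- A nonzero element of `eM` is detected by a homomorphism to the module coinduced from `e`. -/
lemma exists_hom_ne_zero (hE : IsCoinduced e ℓ) {m : M} (hm : e • m ≠ 0) :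
    ∃ h : M →ₗ[A] E, h m ≠ 0 := by
  let : Module K M := Module.compHom M (algebraMap K A)
  have : IsScalarTower K A M := .of_algebraMap_smul fun _ _ => rfl
  obtain ⟨ψ, hψ⟩ : ∃ ψ : M →ₗ[K] K, ψ (e • m) ≠ 0 := by
    by_contra! H
    exact hm ((Module.forall_dual_apply_eq_zero_iff K _).1 H)
  obtain ⟨h, hh⟩ := hE.exists_hom (ψ ∘ₗ DistribSMul.toLinearMap K M e) fun m => by
    simp [smul_smul, hE.idem]
  refine ⟨h, fun h0 => hψ ?_⟩
  simpa [h0] using (hh m).symm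

/-- Homomorphisms to `J` lift along a surjection `E → J` dual to left multiplication by `u`
as soon as `u` acts injectively on `fM`. -/
lemma exists_lift (hE : IsCoinduced e ℓ) {f : A} {J : Type} [AddCommGroup J] [Module K J]
    [Module A J] [IsScalarTower K A J] {μ : J →ₗ[K] K} (hJ : IsCoinduced f μ)
    {u : A} (hu : e * u = u)
    (g : E →ₗ[A] J) (hg : ∀ y, μ (g y) = ℓ (u • y))
    [Module K M] [IsScalarTower K A M] (hM : ∀ m : M, u • m = 0 → f • m = 0) (k : M →ₗ[A] J) :
    ∃ l : M →ₗ[A] E, g ∘ₗ l = k := by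
  obtain ⟨φ, hφ⟩ := (DistribSMul.toLinearMap K M u).exists_comp_eq_of_ker_le
    (μ ∘ₗ k.restrictScalars K) fun m hm => by
      simp only [LinearMap.mem_ker, DistribSMul.toLinearMap_apply] at hm
      have := hM m hm
      rw [LinearMap.mem_ker, LinearMap.comp_apply, LinearMap.restrictScalars_apply,
        ← hJ.apply_smul, ← map_smul, this, map_zero, map_zero]
  replace hφ : ∀ m, φ (u • m) = μ (k m) := fun m => LinearMap.congr_fun hφ m
  obtain ⟨l, hl⟩ := hE.exists_hom (φ ∘ₗ DistribSMul.toLinearMap K M e) fun m => by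
    simp [smul_smul, hE.idem]
  refine ⟨l, hJ.hom_ext fun m => ?_⟩
  rw [LinearMap.comp_apply, hg, ← map_smul, hl, ← hφ]
  simp [smul_smul, hu]

end IsCoinduced

end Coinduced
/-! ### A criterion for classical cotilting modules -/

section Cotilting

variable {K A : Type} [Field K] [Ring A] [Algebra K A]

/-- Let `I₁, I₂, I₃` be the modules coinduced from idempotents `e₁, e₂, e₃` with sum `1`, and
`g : I₁ → I₂` a surjection dual to left multiplication by `u`. A module `C` isomorphic to
`ker g × I₁ × I₃` on which `u` acts injectively on `e₂C` is classical cotilting. -/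
theorem isClassicalCotilting_of_isCoinduced {e₁ e₂ e₃ : A} (he : e₁ + e₂ + e₃ = 1)
    {I₁ I₂ I₃ C : Type}
    [AddCommGroup I₁] [Module K I₁] [Module A I₁] [IsScalarTower K A I₁]
    [AddCommGroup I₂] [Module K I₂] [Module A I₂] [IsScalarTower K A I₂]
    [AddCommGroup I₃] [Module K I₃] [Module A I₃] [IsScalarTower K A I₃]
    [AddCommGroup C] [Module K C] [Module A C] [IsScalarTower K A C]
    {ℓ₁ : I₁ →ₗ[K] K} {ℓ₂ : I₂ →ₗ[K] K} {ℓ₃ : I₃ →ₗ[K] K}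
    (h₁ : IsCoinduced e₁ ℓ₁) (h₂ : IsCoinduced e₂ ℓ₂) (h₃ : IsCoinduced e₃ ℓ₃)
    (g : I₁ →ₗ[A] I₂) (hg : Function.Surjective g) {u : A} (hu : e₁ * u = u)
    (hgu : ∀ y, ℓ₂ (g y) = ℓ₁ (u • y))
    (f : C →ₗ[A] I₁ × I₁ × I₃) (hf : Function.Injective f)
    (hfg : ∀ y, g y.1 = 0 ↔ y ∈ LinearMap.range f)
    (hC : ∀ c : C, u • c = 0 → e₂ • c = 0) : IsClassicalCotilting A C := by
  have inj₁ := h₁.injective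
  have inj₂ := h₂.injective
  have inj₃ := h₃.injective
  have injE := inj₁.prod (inj₁.prod inj₃)
  let p : I₁ × I₁ × I₃ →ₗ[A] I₂ := g ∘ₗ LinearMap.fst A I₁ (I₁ × I₃)
  have hfp : Function.Exact f p := fun y => hfg y
  have hp : Function.Surjective p := fun z => by
    obtain ⟨y, rfl⟩ := hg z
    exact ⟨(y, 0), rfl⟩
  let T : ShortComplex (ModuleCat.{0} A) :=
    ShortComplex.mk (ModuleCat.ofHom f) (ModuleCat.ofHom p)
      (ModuleCat.hom_ext hfp.linearMap_comp_eq_zero)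
  have hT : T.Exact := (ShortComplex.ShortExact.moduleCat_exact_iff_function_exact T).2 hfp
  have : Mono T.f := (ModuleCat.mono_iff_injective _).2 hf
  have : Epi T.g := (ModuleCat.epi_iff_surjective _).2 hp
  have : Injective T.X₂ := Module.injective_object_of_injective_module _ _
  have : Injective T.X₃ := Module.injective_object_of_injective_module _ _
  refine ⟨fun X i hi => extVanish_of_one_lt T hT hi, fun ι => extVanish_one_of_lift T hT ?_, ?_⟩
  · intro k
    obtain ⟨l, hl⟩ := h₁.exists_lift h₂ hu g hgu (M := ι → C)
      (fun m hm => funext fun i => hC _ (congrFun hm i)) k.hom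
    exact ⟨ModuleCat.ofHom ((LinearMap.inl A I₁ (I₁ × I₃)) ∘ₗ l), ModuleCat.hom_ext hl⟩
  · obtain ⟨i, hi⟩ : ∃ i : I₁ × I₃ →ₗ[A] C, ∀ y, f (i y) = (0, y) := by
      refine ⟨(LinearEquiv.ofInjective f hf).symm.toLinearMap ∘ₗ
        (LinearMap.inr A I₁ (I₁ × I₃)).codRestrict (LinearMap.range f)
          fun y => (hfg _).1 (by simp), fun y => ?_⟩
      exact congrArg Subtype.val (LinearEquiv.apply_symm_apply (LinearEquiv.ofInjective f hf) _)
    let q := LinearMap.snd A I₁ (I₁ × I₃) ∘ₗ f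
    have hq : ∀ y, q (i y) = y := fun y => congrArg Prod.snd (hi y)
    refine ⟨ModuleCat.of A (I₂ × I₁ × I₁ × I₃), ModuleCat.of A C,
      ModuleCat.of A ((I₁ × I₁ × I₃) × I₁ × I₁ × I₃),
      ModuleCat.ofHom ((LinearMap.inl A _ _) ∘ₗ f), ModuleCat.ofHom (p.prodMap LinearMap.id),
      ⟨?_, fun X => ⟨X →ₗ[A] I₂ × I₁ × I₁ × I₃, ModuleCat.ofHom (LinearMap.pi id), ?_⟩⟩,
      ⟨Unit, ModuleCat.ofHom (LinearMap.pi fun _ => LinearMap.id),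
        ModuleCat.ofHom (LinearMap.proj ()), rfl⟩,
      ⟨Fin 4, ModuleCat.ofHom (LinearMap.pi
        ![i ∘ₗ LinearMap.inl A _ _ ∘ₗ LinearMap.fst A _ _ ∘ₗ LinearMap.fst A _ _,
          i ∘ₗ LinearMap.snd A _ _ ∘ₗ LinearMap.fst A _ _,
          i ∘ₗ LinearMap.inl A _ _ ∘ₗ LinearMap.fst A _ _ ∘ₗ LinearMap.snd A _ _,
          i ∘ₗ LinearMap.snd A _ _ ∘ₗ LinearMap.snd A _ _]),
        ModuleCat.ofHom (LinearMap.prod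
          ((LinearMap.fst A _ _ ∘ₗ q ∘ₗ LinearMap.proj 0).prod (q ∘ₗ LinearMap.proj 1))
          ((LinearMap.fst A _ _ ∘ₗ q ∘ₗ LinearMap.proj 2).prod (q ∘ₗ LinearMap.proj 3))), ?_⟩,
      ?_, ?_, ?_⟩
    · have := inj₂.prod injE
      exact Module.injective_object_of_injective_module _ _
    · refine (injective_iff_map_eq_zero (LinearMap.pi id)).2 fun x hx => ?_
      replace hx : ∀ h : X →ₗ[A] I₂ × I₁ × I₁ × I₃, h x = 0 := fun h => congrFun hx h
      have hx₁ : e₁ • x = 0 := by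
        by_contra H
        obtain ⟨h, hh⟩ := h₁.exists_hom_ne_zero H
        exact hh (by simpa using hx (LinearMap.prod 0 (LinearMap.prod h 0)))
      have hx₂ : e₂ • x = 0 := by
        by_contra H
        obtain ⟨h, hh⟩ := h₂.exists_hom_ne_zero H
        exact hh (by simpa using hx (LinearMap.prod h 0))
      have hx₃ : e₃ • x = 0 := by
        by_contra H
        obtain ⟨h, hh⟩ := h₃.exists_hom_ne_zero H
        exact hh (by simpa using hx (LinearMap.prod 0 (LinearMap.prod 0 (LinearMap.prod 0 h))))
      rw [← one_smul A x, ← he, add_smul, add_smul, hx₁, hx₂, hx₃, add_zero, add_zero]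
    · refine ModuleCat.hom_ext (LinearMap.ext fun y => ?_)
      simp [hq]
    · exact (LinearMap.inl_injective).comp hf
    · exact hp.prodMap Function.surjective_id
    · rintro ⟨y, y'⟩
      constructor
      · intro h
        obtain ⟨h', rfl⟩ : p y = 0 ∧ y' = 0 := by simpa [Prod.ext_iff] using h
        obtain ⟨c, rfl⟩ := (hfp y).1 h'
        exact ⟨c, rfl⟩
      · rintro ⟨c, hc⟩
        obtain ⟨rfl, rfl⟩ : f c = y ∧ 0 = y' := Prod.ext_iff.1 hc
        exact Prod.ext ((hfp (f c)).2 ⟨c, rfl⟩) rfl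

end Cotilting
/-! ### Rings of triangular matrices are hereditary -/

section Hereditary

/-- The algebra of upper triangular `3 × 3` matrices, i.e. the path algebra of the quiver
`1 → 2 → 3`. -/
def upperTriangular (K : Type) [Field K] : Subalgebra K (Matrix (Fin 3) (Fin 3) K) where
  carrier := {M | M 1 0 = 0 ∧ M 2 0 = 0 ∧ M 2 1 = 0}
  mul_mem' := by
    rintro M N ⟨h₁, h₂, h₃⟩ ⟨h₁', h₂', h₃'⟩
    simp [Matrix.mul_apply, Fin.sum_univ_three, *]
  add_mem' := by
    rintro M N ⟨h₁, h₂, h₃⟩ ⟨h₁', h₂', h₃'⟩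
    simp [*]
  algebraMap_mem' := by
    intro r
    simp [Matrix.algebraMap_matrix_apply]

variable {K A M : Type} [Field K] [Ring A] [Algebra K A] [AddCommGroup M] [Module A M]

/-- The upper triangular matrix with the given entries, row by row. -/
def tri (a b c d e f : K) : upperTriangular K :=
  ⟨!![a, b, c; 0, d, e; 0, 0, f], by simp [upperTriangular]⟩

lemma exists_eq_tri (M : upperTriangular K) : ∃ a b c d e f, M = tri a b c d e f := by
  obtain ⟨M, h₁, h₂, h₃⟩ := M
  refine ⟨M 0 0, M 0 1, M 0 2, M 1 1, M 1 2, M 2 2, Subtype.ext ?_⟩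
  ext i j
  fin_cases i <;> fin_cases j <;> simp [tri, *]

lemma tri_mul (a b c d e f a' b' c' d' e' f' : K) :
    tri a b c d e f * tri a' b' c' d' e' f' = tri (a * a') (a * b' + b * d')
      (a * c' + b * e' + c * f') (d * d') (d * e' + e * f') (f * f') := by
  refine Subtype.ext ?_
  ext i j
  fin_cases i <;> fin_cases j <;> simp [tri, Matrix.mul_apply, Fin.sum_univ_three]

lemma tri_add (a b c d e f a' b' c' d' e' f' : K) :
    tri a b c d e f + tri a' b' c' d' e' f' =
      tri (a + a') (b + b') (c + c') (d + d') (e + e') (f + f') := by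
  refine Subtype.ext ?_
  simp [tri]

lemma tri_smul (k a b c d e f : K) :
    k • tri a b c d e f = tri (k * a) (k * b) (k * c) (k * d) (k * e) (k * f) := by
  refine Subtype.ext ?_
  simp [tri]

lemma tri_one : (1 : upperTriangular K) = tri 1 0 0 1 0 1 := by
  refine Subtype.ext ?_
  simp [tri, Matrix.one_fin_three]

lemma tri_eq_zero {a b c d e f : K} :
    tri a b c d e f = 0 ↔ a = 0 ∧ b = 0 ∧ c = 0 ∧ d = 0 ∧ e = 0 ∧ f = 0 := by
  simp [tri, Subtype.ext_iff, ← Matrix.ext_iff, Fin.forall_fin_succ, and_assoc]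

lemma tri_inj {a b c d e f a' b' c' d' e' f' : K} :
    tri a b c d e f = tri a' b' c' d' e' f' ↔
      a = a' ∧ b = b' ∧ c = c' ∧ d = d' ∧ e = e' ∧ f = f' := by
  simp [tri, Subtype.ext_iff, and_assoc]

lemma zero_eq_tri : (0 : upperTriangular K) = tri 0 0 0 0 0 0 :=
  (tri_eq_zero.2 ⟨rfl, rfl, rfl, rfl, rfl, rfl⟩).symm

/-- Let `A` be generated by orthogonal idempotents `e₀, e₁, e₂` and by arrows `a ∈ e₀Ae₁` and
`b ∈ e₁Ae₂`. An `A`-module on which `a` acts injectively on `e₁M` and `b` on `e₂M`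
is projective. -/
theorem projective_of_injective_arrows {e₀ e₁ e₂ a b : A} (he : e₀ + e₁ + e₂ = 1)
    (h00 : e₀ * e₀ = e₀) (h11 : e₁ * e₁ = e₁) (h22 : e₂ * e₂ = e₂)
    (h01 : e₀ * e₁ = 0) (h02 : e₀ * e₂ = 0) (h10 : e₁ * e₀ = 0) (h12 : e₁ * e₂ = 0)
    (h20 : e₂ * e₀ = 0) (h21 : e₂ * e₁ = 0)
    (ha : e₀ * a * e₁ = a) (hb : e₁ * b * e₂ = b)
    (hgen : Algebra.adjoin K {e₀, e₁, e₂, a, b} = ⊤)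
    (hMa : ∀ m : M, a • m = 0 → e₁ • m = 0) (hMb : ∀ m : M, b • m = 0 → e₂ • m = 0) :
    Module.Projective A M := by
  let : Module K M := Module.compHom M (algebraMap K A)
  have : IsScalarTower K A M := .of_algebraMap_smul fun _ _ => rfl
  refine Module.Projective.of_lifting_property'' fun π hπ => ?_
  obtain ⟨s, hs⟩ := (π.restrictScalars K).exists_rightInverse_of_surjective
    (LinearMap.range_eq_top.2 hπ)
  replace hs : ∀ m, π (s m) = m := fun m => LinearMap.congr_fun hs m
  obtain ⟨q, hq⟩ := (DistribSMul.toLinearMap K M b).exists_comp_eq_of_ker_le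
    (DistribSMul.toLinearMap K M e₂) fun m => hMb m
  obtain ⟨r, hr⟩ := (DistribSMul.toLinearMap K M a).exists_comp_eq_of_ker_le
    (DistribSMul.toLinearMap K M e₁) fun m => hMa m
  replace hq : ∀ m, q (b • m) = e₂ • m := fun m => LinearMap.congr_fun hq m
  replace hr : ∀ m, r (a • m) = e₁ • m := fun m => LinearMap.congr_fun hr m
  have e₀a : e₀ * a = a := by rw [← ha]; simp only [← mul_assoc, h00]
  have ae₁ : a * e₁ = a := by rw [← ha]; simp only [mul_assoc, h11]
  have e₁b : e₁ * b = b := by rw [← hb]; simp only [← mul_assoc, h11]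
  have be₂ : b * e₂ = b := by rw [← hb]; simp only [mul_assoc, h22]
  have e₁a : e₁ * a = 0 := by rw [← e₀a, ← mul_assoc, h10, zero_mul]
  have e₂a : e₂ * a = 0 := by rw [← e₀a, ← mul_assoc, h20, zero_mul]
  have ae₀ : a * e₀ = 0 := by rw [← ae₁, mul_assoc, h10, mul_zero]
  have ae₂ : a * e₂ = 0 := by rw [← ae₁, mul_assoc, h12, mul_zero]
  have e₀b : e₀ * b = 0 := by rw [← e₁b, ← mul_assoc, h01, zero_mul]
  have e₂b : e₂ * b = 0 := by rw [← e₁b, ← mul_assoc, h21, zero_mul]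
  have be₀ : b * e₀ = 0 := by rw [← be₂, mul_assoc, h20, mul_zero]
  have be₁ : b * e₁ = 0 := by rw [← be₂, mul_assoc, h21, mul_zero]
  have aa : a * a = 0 := by nth_rw 2 [← e₀a]; rw [← mul_assoc, ae₀, zero_mul]
  have ba : b * a = 0 := by rw [← e₀a, ← mul_assoc, be₀, zero_mul]
  have bb : b * b = 0 := by nth_rw 2 [← e₁b]; rw [← mul_assoc, be₁, zero_mul]
  let L (c : A) := DistribSMul.toLinearMap K M c
  let L' (c : A) := DistribSMul.toLinearMap K (M →₀ A) c
  obtain ⟨s₂, hs₂⟩ : ∃ t : M →ₗ[K] M →₀ A, ∀ m, t m = e₂ • s (e₂ • m) :=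
    ⟨L' e₂ ∘ₗ s ∘ₗ L e₂, fun _ => rfl⟩
  obtain ⟨s₁, hs₁⟩ : ∃ t : M →ₗ[K] M →₀ A, ∀ m,
      t m = b • s₂ (q (e₁ • m)) + e₁ • s (e₁ • m - b • q (e₁ • m)) :=
    ⟨L' b ∘ₗ s₂ ∘ₗ q ∘ₗ L e₁ + L' e₁ ∘ₗ s ∘ₗ (L e₁ - L b ∘ₗ q ∘ₗ L e₁), fun _ => rfl⟩
  obtain ⟨s₀, hs₀⟩ : ∃ t : M →ₗ[K] M →₀ A, ∀ m,
      t m = a • s₁ (r (e₀ • m)) + e₀ • s (e₀ • m - a • r (e₀ • m)) :=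
    ⟨L' a ∘ₗ s₁ ∘ₗ r ∘ₗ L e₀ + L' e₀ ∘ₗ s ∘ₗ (L e₀ - L a ∘ₗ r ∘ₗ L e₀), fun _ => rfl⟩
  have key : ∀ c : A, ∀ m, (s₀ + s₁ + s₂) (c • m) = c • (s₀ + s₁ + s₂) m := by
    intro c
    have hc : c ∈ Algebra.adjoin K {e₀, e₁, e₂, a, b} := hgen ▸ Algebra.mem_top
    induction hc using Algebra.adjoin_induction with
    | algebraMap k => intro m; rw [algebraMap_smul, algebraMap_smul, map_smul]
    | add x y _ _ hx hy => intro m; rw [add_smul, map_add, hx, hy, add_smul]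
    | mul x y _ _ hx hy => intro m; rw [mul_smul, hx, hy, mul_smul]
    | mem x hx =>
      intro m
      obtain rfl | rfl | rfl | rfl | rfl := hx <;> simp [smul_smul, ← mul_assoc, *]
  refine ⟨{ (s₀ + s₁ + s₂).toAddMonoidHom with map_smul' := key }, LinearMap.ext fun m => ?_⟩
  change π (s₀ m + s₁ m + s₂ m) = m
  refine Eq.trans (b := e₀ • m + e₁ • m + e₂ • m) ?_
    (by rw [← add_smul, ← add_smul, he, one_smul])
  simp only [map_add, map_sub, map_smul, smul_smul, smul_sub, *]
  simp only [add_sub_cancel, smul_smul, ae₁]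

lemma isLeftHereditary_upperTriangular : IsLeftHereditary (upperTriangular K) := by
  intro I
  refine projective_of_injective_arrows (K := K) (e₀ := tri 1 0 0 0 0 0) (e₁ := tri 0 0 0 1 0 0)
    (e₂ := tri 0 0 0 0 0 1) (a := tri 0 1 0 0 0 0) (b := tri 0 0 0 0 1 0)
    (by simp [tri_add, tri_one]) (by simp [tri_mul]) (by simp [tri_mul]) (by simp [tri_mul])
    (by simp [tri_mul, tri_eq_zero]) (by simp [tri_mul, tri_eq_zero])
    (by simp [tri_mul, tri_eq_zero]) (by simp [tri_mul, tri_eq_zero])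
    (by simp [tri_mul, tri_eq_zero]) (by simp [tri_mul, tri_eq_zero])
    (by simp [tri_mul]) (by simp [tri_mul])
    (Algebra.eq_top_iff.2 fun M => ?_) ?_ ?_
  · obtain ⟨a, b, c, d, e, f, rfl⟩ := exists_eq_tri M
    have h := Algebra.subset_adjoin (R := K) (s := {(tri 1 0 0 0 0 0 : upperTriangular K),
      tri 0 0 0 1 0 0, tri 0 0 0 0 0 1, tri 0 1 0 0 0 0, tri 0 0 0 0 1 0})
    simp only [Set.insert_subset_iff, Set.singleton_subset_iff, SetLike.mem_coe] at h
    obtain ⟨h₀, h₁, h₂, h₃, h₄⟩ := h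
    have key := add_mem (add_mem (add_mem (Subalgebra.smul_mem _ h₀ a)
      (Subalgebra.smul_mem _ h₁ d)) (add_mem (Subalgebra.smul_mem _ h₂ f)
      (Subalgebra.smul_mem _ h₃ b))) (add_mem (Subalgebra.smul_mem _ h₄ e)
      (Subalgebra.smul_mem _ (mul_mem h₃ h₄) c))
    simpa [tri_mul, tri_smul, tri_add] using key
  · rintro ⟨m, hm⟩ h
    obtain ⟨a, b, c, d, e, f, rfl⟩ := exists_eq_tri m
    simp only [Subtype.ext_iff, SetLike.val_smul, smul_eq_mul, tri_mul, ZeroMemClass.coe_zero]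
      at h ⊢
    simpa [tri_eq_zero] using h
  · rintro ⟨m, hm⟩ h
    obtain ⟨a, b, c, d, e, f, rfl⟩ := exists_eq_tri m
    simp only [Subtype.ext_iff, SetLike.val_smul, smul_eq_mul, tri_mul, ZeroMemClass.coe_zero]
      at h ⊢
    simpa [tri_eq_zero] using h

end Hereditary

/-! ### Injective modules dual to idempotents -/

section Coinduced

variable (K : Type) {A : Type} [Field K] [Ring A] [Algebra K A]

/-- The `K`-dual of the right `A`-module `eA`, for an idempotent `e`, realized as the space of
functionals on `A` invariant under left multiplication by `e`. -/
def Coinduced (e : A) : Submodule K (A →ₗ[K] K) where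
  carrier := {φ | ∀ a, φ (e * a) = φ a}
  add_mem' hφ hψ a := by simp [hφ a, hψ a]
  zero_mem' _ := rfl
  smul_mem' k φ hφ a := by simp [hφ a]

namespace Coinduced

variable {K} {e f : A}

instance : Module A (Coinduced K e) where
  smul a φ := ⟨φ.1 ∘ₗ LinearMap.mulRight K a, fun b => by simpa [mul_assoc] using φ.2 (b * a)⟩
  one_smul φ := Subtype.ext (LinearMap.ext fun b => congrArg φ.1 (mul_one b))
  mul_smul a a' φ := Subtype.ext (LinearMap.ext fun b => congrArg φ.1 (mul_assoc b a a').symm)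
  smul_zero _ := rfl
  smul_add _ _ _ := rfl
  add_smul a a' φ := Subtype.ext (LinearMap.ext fun b =>
    (congrArg φ.1 (mul_add b a a')).trans (map_add _ _ _))
  zero_smul φ := Subtype.ext (LinearMap.ext fun b =>
    (congrArg φ.1 (mul_zero b)).trans (map_zero _))

lemma smul_apply (a b : A) (φ : Coinduced K e) : (a • φ).1 b = φ.1 (b * a) := rfl

instance : IsScalarTower K A (Coinduced K e) :=
  .of_algebraMap_smul fun k φ => Subtype.ext <| LinearMap.ext fun b => by
    simp [smul_apply, ← Algebra.commutes k b, ← Algebra.smul_def]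

variable (K e) in
/-- Evaluation at `1`. -/
def eval : Coinduced K e →ₗ[K] K := LinearMap.applyₗ 1 ∘ₗ (Coinduced K e).subtype

lemma eval_smul (a : A) (φ : Coinduced K e) : eval K e (a • φ) = φ.1 a :=
  congrArg φ.1 (one_mul a)

lemma isCoinduced (he : e * e = e) :
    IsCoinduced (E := Coinduced K e) e (eval K e) where
  idem := he
  apply_smul φ := (eval_smul e φ).trans ((congrArg φ.1 (mul_one e)).symm.trans (φ.2 1))
  eq_zero φ h := Subtype.ext (LinearMap.ext fun a => (eval_smul a φ).symm.trans (h a))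
  exists_eq φ h := ⟨⟨φ, h⟩, fun _ => eval_smul _ _⟩

/-- The homomorphism dual to left multiplication by `u ∈ eAf`. -/
def map {u : A} (hu' : u * f = u) : Coinduced K e →ₗ[A] Coinduced K f where
  toFun φ := ⟨φ.1 ∘ₗ LinearMap.mulLeft K u, fun a => by simp [← mul_assoc, hu']⟩
  map_add' _ _ := rfl
  map_smul' a φ := Subtype.ext (LinearMap.ext fun b => congrArg φ.1 (mul_assoc u b a))

variable {M : Type} [AddCommGroup M] [Module K M] [Module A M] [IsScalarTower K A M]

/-- The homomorphism to a coinduced module that corresponds to a functional. -/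
def lift (l : M →ₗ[K] K) (hl : ∀ m, l (e • m) = l m) : M →ₗ[A] Coinduced K e where
  toFun m := ⟨l ∘ₗ (LinearMap.toSpanSingleton A M m).restrictScalars K, fun a => by
    simp [mul_smul, hl]⟩
  map_add' m n := Subtype.ext (LinearMap.ext fun a => by simp)
  map_smul' b m := Subtype.ext (LinearMap.ext fun a => by simp [smul_apply, mul_smul])

end Coinduced

/-- A version of `isClassicalCotilting_of_isCoinduced` for the modules `Coinduced K e`. -/
theorem isClassicalCotilting_of_coinduced {K} [Field K] [Algebra K A] {e₁ e₂ e₃ u : A}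
    (he : e₁ + e₂ + e₃ = 1)
    (h₁ : e₁ * e₁ = e₁) (h₂ : e₂ * e₂ = e₂) (h₃ : e₃ * e₃ = e₃) (hu : e₁ * u = u)
    (hu' : u * e₂ = u) (hu₀ : ∀ a, u * a = 0 → e₂ * a = 0)
    {C : Type} [AddCommGroup C] [Module K C] [Module A C] [IsScalarTower K A C]
    (f : C →ₗ[A] Coinduced K e₁ × Coinduced K e₁ × Coinduced K e₃) (hf : Function.Injective f)
    (hfu : ∀ y, (∀ a, y.1.1 (u * a) = 0) ↔ y ∈ LinearMap.range f)
    (hC : ∀ c : C, u • c = 0 → e₂ • c = 0) : IsClassicalCotilting A C := by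
  refine isClassicalCotilting_of_isCoinduced he (Coinduced.isCoinduced h₁)
    (Coinduced.isCoinduced h₂) (Coinduced.isCoinduced h₃) (Coinduced.map hu') (fun φ => ?_) hu
    (fun y => ?_) f hf (fun y => ?_) hC
  · obtain ⟨ψ, hψ⟩ := (LinearMap.mulLeft K u).exists_comp_eq_of_ker_le φ.1 fun a ha => by
      rw [LinearMap.mem_ker, ← φ.2, hu₀ a ha, map_zero]
    refine ⟨⟨ψ ∘ₗ LinearMap.mulLeft K e₁, fun a => by simp [← mul_assoc, h₁]⟩,
      Subtype.ext (LinearMap.ext fun a => ?_)⟩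
    rw [← hψ]
    simp [Coinduced.map, ← mul_assoc, hu]
  · rw [Coinduced.eval_smul]
    exact congrArg y.1 (mul_one u)
  · rw [← hfu, Subtype.ext_iff, LinearMap.ext_iff]
    rfl

end Coinduced

/-! ### The algebra with zero relation -/

section QuotientAlgebra

variable {K : Type} [Field K]

variable (K) in
/-- The path algebra of the quiver `1 → 2 → 3` modulo the path of length two, realized by pairs
of upper triangular `2 × 2` matrices with a common diagonal entry. -/
def zeroRelation : Subalgebra K (Matrix (Fin 2) (Fin 2) K × Matrix (Fin 2) (Fin 2) K) where
  carrier := {p | p.1 1 0 = 0 ∧ p.2 1 0 = 0 ∧ p.1 1 1 = p.2 0 0}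
  mul_mem' := by
    rintro p q ⟨h₁, h₂, h₃⟩ ⟨h₁', h₂', h₃'⟩
    simp [Matrix.mul_apply, *]
  add_mem' := by
    rintro p q ⟨h₁, h₂, h₃⟩ ⟨h₁', h₂', h₃'⟩
    simp [*]
  algebraMap_mem' := by
    intro r
    simp [Matrix.algebraMap_matrix_apply]

/-- The element of `zeroRelation K` with diagonal part `d₁, d₂, d₃` and coefficients `a, b` at
the two arrows. -/
def quo (d₁ a d₂ b d₃ : K) : zeroRelation K :=
  ⟨(!![d₁, a; 0, d₂], !![d₂, b; 0, d₃]), rfl, rfl, rfl⟩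

lemma exists_eq_quo (r : zeroRelation K) : ∃ d₁ a d₂ b d₃, r = quo d₁ a d₂ b d₃ := by
  obtain ⟨⟨M, N⟩, h₁ : M 1 0 = 0, h₂ : N 1 0 = 0, h₃ : M 1 1 = N 0 0⟩ := r
  refine ⟨M 0 0, M 0 1, M 1 1, N 0 1, N 1 1, Subtype.ext (Prod.ext ?_ ?_)⟩ <;>
  · ext i j
    fin_cases i <;> fin_cases j <;> simp [quo, *]

lemma quo_mul (d₁ a d₂ b d₃ d₁' a' d₂' b' d₃' : K) :
    quo d₁ a d₂ b d₃ * quo d₁' a' d₂' b' d₃' =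
      quo (d₁ * d₁') (d₁ * a' + a * d₂') (d₂ * d₂') (d₂ * b' + b * d₃') (d₃ * d₃') := by
  refine Subtype.ext (Prod.ext ?_ ?_) <;> simp [quo]

lemma quo_add (d₁ a d₂ b d₃ d₁' a' d₂' b' d₃' : K) :
    quo d₁ a d₂ b d₃ + quo d₁' a' d₂' b' d₃' =
      quo (d₁ + d₁') (a + a') (d₂ + d₂') (b + b') (d₃ + d₃') := by
  refine Subtype.ext (Prod.ext ?_ ?_) <;> simp [quo]

lemma quo_smul (k d₁ a d₂ b d₃ : K) :
    k • quo d₁ a d₂ b d₃ = quo (k * d₁) (k * a) (k * d₂) (k * b) (k * d₃) := by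
  refine Subtype.ext (Prod.ext ?_ ?_) <;> simp [quo]

lemma quo_one : (1 : zeroRelation K) = quo 1 0 1 0 1 := by
  refine Subtype.ext (Prod.ext ?_ ?_) <;> simp [quo, Matrix.one_fin_two]

lemma quo_inj {d₁ a d₂ b d₃ d₁' a' d₂' b' d₃' : K} :
    quo d₁ a d₂ b d₃ = quo d₁' a' d₂' b' d₃' ↔
      d₁ = d₁' ∧ a = a' ∧ d₂ = d₂' ∧ b = b' ∧ d₃ = d₃' := by
  simp [quo, Subtype.ext_iff]
  tauto

lemma zero_eq_quo : (0 : zeroRelation K) = quo 0 0 0 0 0 := by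
  rw [← zero_smul K 1, quo_one, quo_smul]
  simp

lemma quo_eq_zero {d₁ a d₂ b d₃ : K} :
    quo d₁ a d₂ b d₃ = 0 ↔ d₁ = 0 ∧ a = 0 ∧ d₂ = 0 ∧ b = 0 ∧ d₃ = 0 := by
  rw [← quo_inj, zero_eq_quo]

variable (K) in
/-- The epimorphism killing the path of length two. -/
def killPath : upperTriangular K →ₐ[K] zeroRelation K :=
  AlgHom.ofLinearMap
    { toFun := fun M => quo (M.1 0 0) (M.1 0 1) (M.1 1 1) (M.1 1 2) (M.1 2 2)
      map_add' := fun _ _ => (quo_add ..).symm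
      map_smul' := fun _ _ => (quo_smul ..).symm }
    (by
      rw [tri_one, quo_one]
      rfl)
    (fun M N => by
      obtain ⟨a, b, c, d, e, f, rfl⟩ := exists_eq_tri M
      obtain ⟨a', b', c', d', e', f', rfl⟩ := exists_eq_tri N
      rw [tri_mul]
      exact (quo_mul ..).symm)

lemma killPath_tri (a b c d e f : K) : killPath K (tri a b c d e f) = quo a b d e f := rfl

lemma killPath_surjective : Function.Surjective (killPath K) := fun r => by
  obtain ⟨d₁, a, d₂, b, d₃, rfl⟩ := exists_eq_quo r
  exact ⟨tri d₁ a 0 d₂ b d₃, killPath_tri ..⟩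

lemma finrank_ker_killPath : Module.finrank K
    ((RingHom.ker (killPath K : upperTriangular K →+* zeroRelation K)).restrictScalars K) = 1 := by
  have h : (RingHom.ker (killPath K : upperTriangular K →+* zeroRelation K)).restrictScalars K =
      Submodule.span K {tri 0 0 1 0 0 0} := by
    ext M
    obtain ⟨a, b, c, d, e, f, rfl⟩ := exists_eq_tri M
    rw [Submodule.mem_span_singleton]
    refine quo_eq_zero.trans ⟨?_, ?_⟩
    · rintro ⟨rfl, rfl, rfl, rfl, rfl⟩
      exact ⟨c, (tri_smul ..).trans (by simp)⟩
    · rintro ⟨k, hk⟩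
      rw [tri_smul, tri_inj] at hk
      obtain ⟨rfl, rfl, -, rfl, rfl, rfl⟩ := hk
      simp [tri]
  rw [h]
  exact finrank_span_singleton (by simp [tri_eq_zero])

end QuotientAlgebra

/-! ### The cotilting bimodule -/

section Bimodule

/-- The vector space underlying the `5`-dimensional cotilting bimodule. -/
def CotiltingSpace (K : Type) : Type := Fin 5 → K

namespace CotiltingSpace

variable {K : Type}

/-- The vector with the given coordinates; the coordinates `1, 2, 3` span the uniserial left
submodule of length three. -/
def vec (x₀ x₁ x₂ x₃ x₄ : K) : CotiltingSpace K := ![x₀, x₁, x₂, x₃, x₄]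

lemma exists_eq_vec (c : CotiltingSpace K) : ∃ x₀ x₁ x₂ x₃ x₄, c = vec x₀ x₁ x₂ x₃ x₄ := by
  refine ⟨c 0, c 1, c 2, c 3, c 4, funext fun i => ?_⟩
  fin_cases i <;> rfl

lemma vec_inj {x₀ x₁ x₂ x₃ x₄ y₀ y₁ y₂ y₃ y₄ : K} : vec x₀ x₁ x₂ x₃ x₄ = vec y₀ y₁ y₂ y₃ y₄ ↔
    x₀ = y₀ ∧ x₁ = y₁ ∧ x₂ = y₂ ∧ x₃ = y₃ ∧ x₄ = y₄ := by
  change ![x₀, x₁, x₂, x₃, x₄] = (![y₀, y₁, y₂, y₃, y₄] : Fin 5 → K) ↔ _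
  simp

lemma forall_vec {p : CotiltingSpace K → Prop} :
    (∀ c, p c) ↔ ∀ x₀ x₁ x₂ x₃ x₄, p (vec x₀ x₁ x₂ x₃ x₄) := by
  refine ⟨fun h _ _ _ _ _ => h _, fun h c => ?_⟩
  obtain ⟨x₀, x₁, x₂, x₃, x₄, rfl⟩ := exists_eq_vec c
  exact h ..

variable [Field K]

instance : AddCommGroup (CotiltingSpace K) := inferInstanceAs (AddCommGroup (Fin 5 → K))

instance : Module K (CotiltingSpace K) := inferInstanceAs (Module K (Fin 5 → K))

instance : FiniteDimensional K (CotiltingSpace K) :=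
  inferInstanceAs (FiniteDimensional K (Fin 5 → K))

lemma vec_eq_zero {x₀ x₁ x₂ x₃ x₄ : K} : vec x₀ x₁ x₂ x₃ x₄ = 0 ↔
    x₀ = 0 ∧ x₁ = 0 ∧ x₂ = 0 ∧ x₃ = 0 ∧ x₄ = 0 := by
  rw [← vec_inj]
  refine Eq.congr_right (funext fun i => ?_)
  fin_cases i <;> rfl

lemma vec_add (x₀ x₁ x₂ x₃ x₄ y₀ y₁ y₂ y₃ y₄ : K) : vec x₀ x₁ x₂ x₃ x₄ + vec y₀ y₁ y₂ y₃ y₄ =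
    vec (x₀ + y₀) (x₁ + y₁) (x₂ + y₂) (x₃ + y₃) (x₄ + y₄) := by
  refine funext fun i => ?_
  fin_cases i <;> rfl

lemma smul_vec (k x₀ x₁ x₂ x₃ x₄ : K) :
    k • vec x₀ x₁ x₂ x₃ x₄ = vec (k * x₀) (k * x₁) (k * x₂) (k * x₃) (k * x₄) := by
  refine funext fun i => ?_
  fin_cases i <;> rfl

instance : SMul (upperTriangular K) (CotiltingSpace K) where
  smul M c := vec (M.1 0 0 * c 0) (M.1 2 2 * c 1) (M.1 1 1 * c 2 + M.1 1 2 * c 1)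
    (M.1 0 0 * c 3 + M.1 0 1 * c 2 + M.1 0 2 * c 1) (M.1 2 2 * c 4)

instance : SMul (zeroRelation K)ᵐᵒᵖ (CotiltingSpace K) where
  smul r c := vec (c 0 * r.unop.1.1 0 0) (c 1 * r.unop.1.1 1 1) (c 2 * r.unop.1.1 1 1)
    (c 3 * r.unop.1.1 1 1 + c 0 * r.unop.1.1 0 1) (c 4 * r.unop.1.2 1 1 + c 1 * r.unop.1.2 0 1)

lemma tri_smul_vec (a b c d e f x₀ x₁ x₂ x₃ x₄ : K) : tri a b c d e f • vec x₀ x₁ x₂ x₃ x₄ =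
    vec (a * x₀) (f * x₁) (d * x₂ + e * x₁) (a * x₃ + b * x₂ + c * x₁) (f * x₄) := rfl

lemma op_quo_smul_vec (d₁ a d₂ b d₃ x₀ x₁ x₂ x₃ x₄ : K) :
    MulOpposite.op (quo d₁ a d₂ b d₃) • vec x₀ x₁ x₂ x₃ x₄ =
      vec (x₀ * d₁) (x₁ * d₂) (x₂ * d₂) (x₃ * d₂ + x₀ * a) (x₄ * d₃ + x₁ * b) := rfl

lemma zero_eq_vec : (0 : CotiltingSpace K) = vec 0 0 0 0 0 :=
  (vec_eq_zero.2 ⟨rfl, rfl, rfl, rfl, rfl⟩).symm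

lemma forall_tri {p : upperTriangular K → Prop} :
    (∀ M, p M) ↔ ∀ a b c d e f, p (tri a b c d e f) := by
  refine ⟨fun h _ _ _ _ _ _ => h _, fun h M => ?_⟩
  obtain ⟨a, b, c, d, e, f, rfl⟩ := exists_eq_tri M
  exact h ..

lemma forall_op_quo {p : (zeroRelation K)ᵐᵒᵖ → Prop} :
    (∀ r, p r) ↔ ∀ d₁ a d₂ b d₃, p (MulOpposite.op (quo d₁ a d₂ b d₃)) := by
  refine ⟨fun h _ _ _ _ _ => h _, fun h r => ?_⟩
  obtain ⟨d₁, a, d₂, b, d₃, h'⟩ := exists_eq_quo r.unop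
  rw [← r.op_unop, h']
  exact h ..

instance : Module (upperTriangular K) (CotiltingSpace K) where
  one_smul := by simp [forall_vec, tri_one, tri_smul_vec]
  mul_smul := by
    simp only [forall_vec, forall_tri, tri_mul, tri_smul_vec, vec_inj]
    intros
    refine ⟨?_, ?_, ?_, ?_, ?_⟩ <;> ring
  smul_zero := by
    simp only [forall_tri, zero_eq_vec, tri_smul_vec, mul_zero, add_zero, implies_true]
  smul_add := by
    simp only [forall_vec, forall_tri, vec_add, tri_smul_vec, vec_inj]
    intros
    refine ⟨?_, ?_, ?_, ?_, ?_⟩ <;> ring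
  add_smul := by
    simp only [forall_vec, forall_tri, vec_add, tri_add, tri_smul_vec, vec_inj]
    intros
    refine ⟨?_, ?_, ?_, ?_, ?_⟩ <;> ring
  zero_smul := by
    simp only [forall_vec, zero_eq_tri, zero_eq_vec, tri_smul_vec, zero_mul, add_zero,
      implies_true]

instance : Module (zeroRelation K)ᵐᵒᵖ (CotiltingSpace K) where
  one_smul := by simp [forall_vec, ← MulOpposite.op_one, quo_one, op_quo_smul_vec]
  mul_smul := by
    simp only [forall_vec, forall_op_quo, ← MulOpposite.op_mul, quo_mul, op_quo_smul_vec, vec_inj]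
    intros
    refine ⟨?_, ?_, ?_, ?_, ?_⟩ <;> ring
  smul_zero := by
    simp only [forall_op_quo, zero_eq_vec, op_quo_smul_vec, zero_mul, add_zero, implies_true]
  smul_add := by
    simp only [forall_vec, forall_op_quo, vec_add, op_quo_smul_vec, vec_inj]
    intros
    refine ⟨?_, ?_, ?_, ?_, ?_⟩ <;> ring
  add_smul := by
    simp only [forall_vec, forall_op_quo, vec_add, ← MulOpposite.op_add, quo_add,
      op_quo_smul_vec, vec_inj]
    intros
    refine ⟨?_, ?_, ?_, ?_, ?_⟩ <;> ring
  zero_smul := by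
    simp only [forall_vec, ← MulOpposite.op_zero, zero_eq_quo, zero_eq_vec, op_quo_smul_vec,
      mul_zero, add_zero, implies_true]

instance : SMulCommClass (upperTriangular K) (zeroRelation K)ᵐᵒᵖ (CotiltingSpace K) where
  smul_comm := by
    simp only [forall_vec, forall_tri, forall_op_quo, tri_smul_vec, op_quo_smul_vec, vec_inj]
    intros
    refine ⟨?_, ?_, ?_, ?_, ?_⟩ <;> ring

instance : IsScalarTower K (upperTriangular K) (CotiltingSpace K) where
  smul_assoc := by
    simp only [forall_vec, forall_tri, tri_smul, tri_smul_vec, smul_vec, vec_inj]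
    intros
    refine ⟨?_, ?_, ?_, ?_, ?_⟩ <;> ring

instance : IsScalarTower K (zeroRelation K)ᵐᵒᵖ (CotiltingSpace K) where
  smul_assoc := by
    simp only [forall_vec, forall_op_quo, ← MulOpposite.op_smul, quo_smul, op_quo_smul_vec,
      smul_vec, vec_inj]
    intros
    refine ⟨?_, ?_, ?_, ?_, ?_⟩ <;> ring

end CotiltingSpace

end Bimodule

section Balanced

variable {K : Type} [Field K]

namespace CotiltingSpace

lemma hom_ext {φ ψ : CotiltingSpace K →ₗ[K] CotiltingSpace K}
    (h₀ : φ (vec 1 0 0 0 0) = ψ (vec 1 0 0 0 0)) (h₁ : φ (vec 0 1 0 0 0) = ψ (vec 0 1 0 0 0))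
    (h₂ : φ (vec 0 0 1 0 0) = ψ (vec 0 0 1 0 0)) (h₃ : φ (vec 0 0 0 1 0) = ψ (vec 0 0 0 1 0))
    (h₄ : φ (vec 0 0 0 0 1) = ψ (vec 0 0 0 0 1)) : φ = ψ := by
  refine LinearMap.ext (forall_vec.2 fun x₀ x₁ x₂ x₃ x₄ => ?_)
  have h : vec x₀ x₁ x₂ x₃ x₄ = x₀ • vec 1 0 0 0 0 + x₁ • vec 0 1 0 0 0 + x₂ • vec 0 0 1 0 0 +
      x₃ • vec 0 0 0 1 0 + x₄ • vec 0 0 0 0 1 := by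
    simp [smul_vec, vec_add]
  simp only [h, map_add, map_smul, h₀, h₁, h₂, h₃, h₄]

theorem bijective_toModuleEnd_left : Function.Bijective
    (Module.toModuleEnd (zeroRelation K)ᵐᵒᵖ (CotiltingSpace K) :
      upperTriangular K →+* Module.End (zeroRelation K)ᵐᵒᵖ (CotiltingSpace K)) := by
  constructor
  · refine (injective_iff_map_eq_zero _).2 fun M hM => ?_
    obtain ⟨a, b, c, d, e, f, rfl⟩ := exists_eq_tri M
    have h₀ : tri a b c d e f • (vec 1 0 0 0 0 : CotiltingSpace K) = 0 :=
      LinearMap.congr_fun hM _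
    have h₁ : tri a b c d e f • (vec 0 1 0 0 0 : CotiltingSpace K) = 0 :=
      LinearMap.congr_fun hM _
    have h₂ : tri a b c d e f • (vec 0 0 1 0 0 : CotiltingSpace K) = 0 :=
      LinearMap.congr_fun hM _
    simp only [tri_smul_vec, vec_eq_zero] at h₀ h₁ h₂
    simp_all [tri_eq_zero]
  · intro φ
    obtain ⟨p₀, p₁, p₂, p₃, p₄, hp⟩ := exists_eq_vec (φ (vec 0 1 0 0 0))
    obtain ⟨q₀, q₁, q₂, q₃, q₄, hq⟩ := exists_eq_vec (φ (vec 0 0 1 0 0))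
    obtain ⟨x₀, x₁, x₂, x₃, x₄, hx⟩ := exists_eq_vec (φ (vec 1 0 0 0 0))
    have hs := φ.map_smul (MulOpposite.op (quo 0 0 0 1 0)) (vec 0 1 0 0 0)
    have ht := φ.map_smul (MulOpposite.op (quo 0 1 0 0 0)) (vec 1 0 0 0 0)
    have h₁ := φ.map_smul (MulOpposite.op (quo 0 0 1 0 0)) (vec 0 1 0 0 0)
    have h₂ := φ.map_smul (MulOpposite.op (quo 0 0 1 0 0)) (vec 0 0 1 0 0)
    have h₃ := φ.map_smul (MulOpposite.op (quo 0 0 0 1 0)) (vec 0 0 1 0 0)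
    have h₄ := φ.map_smul (MulOpposite.op (quo 1 0 0 0 0)) (vec 1 0 0 0 0)
    simp only [op_quo_smul_vec, mul_zero, mul_one, add_zero, zero_add, hp, hq, hx, vec_inj,
      ← zero_eq_vec, map_zero] at hs ht h₁ h₂ h₃ h₄
    have h₃' := vec_eq_zero.1 h₃.symm
    refine ⟨tri x₀ q₃ p₃ q₂ p₂ p₁, LinearMap.ext fun c => LinearMap.congr_fun (f :=
      (Module.toModuleEnd (zeroRelation K)ᵐᵒᵖ (CotiltingSpace K)
        (tri x₀ q₃ p₃ q₂ p₂ p₁)).restrictScalars K) (g := φ.restrictScalars K)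
      (hom_ext ?_ ?_ ?_ ?_ ?_) c⟩
    all_goals
      simp only [LinearMap.restrictScalars_apply, Module.toModuleEnd_apply,
        DistribSMul.toLinearMap_apply, tri_smul_vec, hs, ht, hp, hq, hx, vec_inj]
      simp_all

theorem bijective_toModuleEnd_right :
    let : SMulCommClass (zeroRelation K)ᵐᵒᵖ (upperTriangular K) (CotiltingSpace K) :=
      SMulCommClass.symm ..
    Function.Bijective (Module.toModuleEnd (upperTriangular K) (CotiltingSpace K) :
      (zeroRelation K)ᵐᵒᵖ →+* Module.End (upperTriangular K) (CotiltingSpace K)) := by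
  intro
  constructor
  · refine (injective_iff_map_eq_zero _).2 (forall_op_quo.2 fun d₁ a d₂ b d₃ hM => ?_)
    have h₀ : MulOpposite.op (quo d₁ a d₂ b d₃) • (vec 1 0 0 0 0 : CotiltingSpace K) = 0 :=
      LinearMap.congr_fun hM _
    have h₁ : MulOpposite.op (quo d₁ a d₂ b d₃) • (vec 0 1 0 0 0 : CotiltingSpace K) = 0 :=
      LinearMap.congr_fun hM _
    have h₂ : MulOpposite.op (quo d₁ a d₂ b d₃) • (vec 0 0 0 0 1 : CotiltingSpace K) = 0 :=
      LinearMap.congr_fun hM _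
    simp only [op_quo_smul_vec, vec_eq_zero] at h₀ h₁ h₂
    simp_all [quo_eq_zero]
  · intro φ
    obtain ⟨p₀, p₁, p₂, p₃, p₄, hp⟩ := exists_eq_vec (φ (vec 0 1 0 0 0))
    obtain ⟨s₀, s₁, s₂, s₃, s₄, hs⟩ := exists_eq_vec (φ (vec 0 0 0 0 1))
    obtain ⟨x₀, x₁, x₂, x₃, x₄, hx⟩ := exists_eq_vec (φ (vec 1 0 0 0 0))
    have hq := φ.map_smul (tri 0 0 0 0 1 0) (vec 0 1 0 0 0)
    have ht := φ.map_smul (tri 0 0 1 0 0 0) (vec 0 1 0 0 0)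
    have h₁ := φ.map_smul (tri 0 0 0 0 0 1) (vec 0 1 0 0 0)
    have h₂ := φ.map_smul (tri 0 0 0 0 0 1) (vec 0 0 0 0 1)
    have h₃ := φ.map_smul (tri 0 0 0 0 1 0) (vec 0 0 0 0 1)
    have h₄ := φ.map_smul (tri 1 0 0 0 0 0) (vec 1 0 0 0 0)
    simp only [tri_smul_vec, mul_zero, mul_one, add_zero, zero_add, hp, hs, hx, vec_inj,
      ← zero_eq_vec, map_zero, zero_mul, one_mul] at hq ht h₁ h₂ h₃ h₄
    have h₃' := vec_eq_zero.1 h₃.symm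
    refine ⟨MulOpposite.op (quo x₀ x₃ p₁ p₄ s₄), LinearMap.ext fun c => LinearMap.congr_fun (f :=
      (Module.toModuleEnd (upperTriangular K) (CotiltingSpace K)
        (MulOpposite.op (quo x₀ x₃ p₁ p₄ s₄))).restrictScalars K) (g := φ.restrictScalars K)
      (hom_ext ?_ ?_ ?_ ?_ ?_) c⟩
    all_goals
      simp only [LinearMap.restrictScalars_apply, Module.toModuleEnd_apply,
        DistribSMul.toLinearMap_apply, op_quo_smul_vec, hs, ht, hp, hq, hx, vec_inj]
      simp_all

end CotiltingSpace

end Balanced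

/-! ### Cotilting on both sides -/

section CotiltingSides

variable {K : Type} [Field K]

namespace Coinduced

lemma apply_tri_of_first (φ : Coinduced K (tri 1 0 0 0 0 0 : upperTriangular K))
    (a b c d e f : K) : φ.1 (tri a b c d e f) =
      a * φ.1 (tri 1 0 0 0 0 0) + b * φ.1 (tri 0 1 0 0 0 0) + c * φ.1 (tri 0 0 1 0 0 0) := by
  rw [← φ.2]
  simp only [← smul_eq_mul, ← map_smul, ← map_add]
  simp [tri_mul, tri_smul, tri_add]

lemma apply_tri_of_last (φ : Coinduced K (tri 0 0 0 0 0 1 : upperTriangular K))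
    (a b c d e f : K) : φ.1 (tri a b c d e f) = f * φ.1 (tri 0 0 0 0 0 1) := by
  rw [← φ.2]
  simp only [← smul_eq_mul, ← map_smul]
  simp [tri_mul, tri_smul]

lemma apply_op_quo_of_middle (φ : Coinduced K (MulOpposite.op (quo 0 0 1 0 0 : zeroRelation K)))
    (d₁ a d₂ b d₃ : K) : φ.1 (.op (quo d₁ a d₂ b d₃)) =
      a * φ.1 (.op (quo 0 1 0 0 0)) + d₂ * φ.1 (.op (quo 0 0 1 0 0)) := by
  rw [← φ.2]
  simp only [← smul_eq_mul, ← map_smul, ← map_add]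
  simp [← MulOpposite.op_smul, ← MulOpposite.op_add, quo_mul, quo_smul, quo_add, -smul_eq_mul]

lemma apply_op_quo_of_last (φ : Coinduced K (MulOpposite.op (quo 0 0 0 0 1 : zeroRelation K)))
    (d₁ a d₂ b d₃ : K) : φ.1 (.op (quo d₁ a d₂ b d₃)) =
      b * φ.1 (.op (quo 0 0 0 1 0)) + d₃ * φ.1 (.op (quo 0 0 0 0 1)) := by
  rw [← φ.2]
  simp only [← smul_eq_mul, ← map_smul, ← map_add]
  simp [← MulOpposite.op_smul, ← MulOpposite.op_add, quo_mul, quo_smul, quo_add, -smul_eq_mul]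

end Coinduced

namespace CotiltingSpace

/-- A coordinate functional. -/
def coord (i : Fin 5) : CotiltingSpace K →ₗ[K] K := LinearMap.proj (R := K) (φ := fun _ => K) i

lemma coord_vec (i : Fin 5) (x₀ x₁ x₂ x₃ x₄ : K) :
    coord i (vec x₀ x₁ x₂ x₃ x₄) = ![x₀, x₁, x₂, x₃, x₄] i := rfl

variable (K) in
/-- The underlying left module of the injective envelope of `CotiltingSpace K`. -/
abbrev Envelope : Type :=
  Coinduced K (tri 1 0 0 0 0 0 : upperTriangular K) ×
    Coinduced K (tri 1 0 0 0 0 0 : upperTriangular K) ×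
      Coinduced K (tri 0 0 0 0 0 1 : upperTriangular K)

variable (K) in
/-- The embedding of `CotiltingSpace K` into its injective envelope. -/
def toEnvelope : CotiltingSpace K →ₗ[upperTriangular K] Envelope K :=
  (Coinduced.lift (coord 0) (by simp [forall_vec, tri_smul_vec, coord_vec])).prod
    ((Coinduced.lift (coord 3) (by simp [forall_vec, tri_smul_vec, coord_vec])).prod
      (Coinduced.lift (coord 4) (by simp [forall_vec, tri_smul_vec, coord_vec])))

lemma toEnvelope_fst (c : CotiltingSpace K) (M : upperTriangular K) :
    (toEnvelope K c).1.1 M = coord 0 (M • c) := rfl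

lemma toEnvelope_snd_fst (c : CotiltingSpace K) (M : upperTriangular K) :
    (toEnvelope K c).2.1.1 M = coord 3 (M • c) := rfl

lemma toEnvelope_snd_snd (c : CotiltingSpace K) (M : upperTriangular K) :
    (toEnvelope K c).2.2.1 M = coord 4 (M • c) := rfl

lemma toEnvelope_injective : Function.Injective (toEnvelope K) := by
  refine (injective_iff_map_eq_zero _).2 (forall_vec.2 fun x₀ x₁ x₂ x₃ x₄ h => ?_)
  have h₀ := toEnvelope_fst (vec x₀ x₁ x₂ x₃ x₄) (tri 1 0 0 0 0 0)
  have h₁ := toEnvelope_snd_fst (vec x₀ x₁ x₂ x₃ x₄) (tri 0 0 1 0 0 0)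
  have h₂ := toEnvelope_snd_fst (vec x₀ x₁ x₂ x₃ x₄) (tri 0 1 0 0 0 0)
  have h₃ := toEnvelope_snd_fst (vec x₀ x₁ x₂ x₃ x₄) (tri 1 0 0 0 0 0)
  have h₄ := toEnvelope_snd_snd (vec x₀ x₁ x₂ x₃ x₄) (tri 0 0 0 0 0 1)
  simp [h, tri_smul_vec, coord_vec] at h₀ h₁ h₂ h₃ h₄
  exact vec_eq_zero.2 ⟨h₀.symm, h₁.symm, h₂.symm, h₃.symm, h₄.symm⟩

lemma mem_range_toEnvelope (y : Envelope K) :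
    (∀ M, y.1.1 (tri 0 1 0 0 0 0 * M) = 0) ↔ y ∈ LinearMap.range (toEnvelope K) := by
  constructor
  · intro h
    have h₁ := h (tri 0 0 0 1 0 0)
    have h₂ := h (tri 0 0 0 0 1 0)
    simp [tri_mul] at h₁ h₂
    refine ⟨vec (y.1.1 (tri 1 0 0 0 0 0)) (y.2.1.1 (tri 0 0 1 0 0 0)) (y.2.1.1 (tri 0 1 0 0 0 0))
      (y.2.1.1 (tri 1 0 0 0 0 0)) (y.2.2.1 (tri 0 0 0 0 0 1)), Prod.ext ?_ (Prod.ext ?_ ?_)⟩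
    all_goals refine Subtype.ext (LinearMap.ext (forall_tri.2 fun a b c d e f => ?_))
    · rw [toEnvelope_fst, Coinduced.apply_tri_of_first _ a b, h₁, h₂]
      simp [tri_smul_vec, coord_vec]
    · rw [toEnvelope_snd_fst, Coinduced.apply_tri_of_first _ a b]
      simp [tri_smul_vec, coord_vec]
    · rw [toEnvelope_snd_snd, Coinduced.apply_tri_of_last _ a b]
      simp [tri_smul_vec, coord_vec]
  · rintro ⟨c, rfl⟩
    revert c
    simp only [forall_vec, forall_tri, toEnvelope_fst, tri_mul, tri_smul_vec, coord_vec]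
    simp

theorem isClassicalCotilting_left :
    IsClassicalCotilting (upperTriangular K) (CotiltingSpace K) := by
  refine isClassicalCotilting_of_coinduced (e₂ := tri 0 0 0 1 0 0) (u := tri 0 1 0 0 0 0)
    (by simp [tri_add, tri_one]) (by simp [tri_mul]) (by simp [tri_mul]) (by simp [tri_mul])
    (by simp [tri_mul]) (by simp [tri_mul])
    (forall_tri.2 fun a b c d e f => ?_) (toEnvelope K) toEnvelope_injective mem_range_toEnvelope
    (forall_vec.2 fun x₀ x₁ x₂ x₃ x₄ => ?_)
  · simp [tri_mul, tri_eq_zero]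
  · simp [tri_smul_vec, vec_eq_zero]

/-- The right module counterpart of `toEnvelope`. -/
def toRightEnvelope : CotiltingSpace K →ₗ[(zeroRelation K)ᵐᵒᵖ]
    Coinduced K (MulOpposite.op (quo 0 0 1 0 0 : zeroRelation K)) ×
      Coinduced K (MulOpposite.op (quo 0 0 1 0 0 : zeroRelation K)) ×
        Coinduced K (MulOpposite.op (quo 0 0 0 0 1 : zeroRelation K)) :=
  (Coinduced.lift (coord 2) (by simp [forall_vec, op_quo_smul_vec, coord_vec])).prod
    ((Coinduced.lift (coord 3) (by simp [forall_vec, op_quo_smul_vec, coord_vec])).prod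
      (Coinduced.lift (coord 4) (by simp [forall_vec, op_quo_smul_vec, coord_vec])))

lemma toRightEnvelope_fst (c : CotiltingSpace K) (r : (zeroRelation K)ᵐᵒᵖ) :
    (toRightEnvelope c).1.1 r = coord 2 (r • c) := rfl

lemma toRightEnvelope_snd_fst (c : CotiltingSpace K) (r : (zeroRelation K)ᵐᵒᵖ) :
    (toRightEnvelope c).2.1.1 r = coord 3 (r • c) := rfl

lemma toRightEnvelope_snd_snd (c : CotiltingSpace K) (r : (zeroRelation K)ᵐᵒᵖ) :
    (toRightEnvelope c).2.2.1 r = coord 4 (r • c) := rfl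

theorem isClassicalCotilting_right :
    IsClassicalCotilting (zeroRelation K)ᵐᵒᵖ (CotiltingSpace K) := by
  refine isClassicalCotilting_of_coinduced (e₂ := .op (quo 1 0 0 0 0)) (u := .op (quo 0 1 0 0 0))
    (by simp [← MulOpposite.op_add, quo_add, ← quo_one])
    (by simp [← MulOpposite.op_mul, quo_mul]) (by simp [← MulOpposite.op_mul, quo_mul])
    (by simp [← MulOpposite.op_mul, quo_mul]) (by simp [← MulOpposite.op_mul, quo_mul])
    (by simp [← MulOpposite.op_mul, quo_mul]) (forall_op_quo.2 fun d₁ a d₂ b d₃ => ?_)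
    toRightEnvelope ?_ (fun y => ⟨fun h => ?_, ?_⟩) (forall_vec.2 fun x₀ x₁ x₂ x₃ x₄ => ?_)
  · simp [← MulOpposite.op_mul, quo_mul, quo_eq_zero]
  · refine (injective_iff_map_eq_zero _).2 (forall_vec.2 fun x₀ x₁ x₂ x₃ x₄ h => ?_)
    have h₀ := toRightEnvelope_snd_fst (vec x₀ x₁ x₂ x₃ x₄) (.op (quo 0 1 0 0 0))
    have h₁ := toRightEnvelope_snd_snd (vec x₀ x₁ x₂ x₃ x₄) (.op (quo 0 0 0 1 0))
    have h₂ := toRightEnvelope_fst (vec x₀ x₁ x₂ x₃ x₄) (.op (quo 0 0 1 0 0))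
    have h₃ := toRightEnvelope_snd_fst (vec x₀ x₁ x₂ x₃ x₄) (.op (quo 0 0 1 0 0))
    have h₄ := toRightEnvelope_snd_snd (vec x₀ x₁ x₂ x₃ x₄) (.op (quo 0 0 0 0 1))
    simp [h, op_quo_smul_vec, coord_vec] at h₀ h₁ h₂ h₃ h₄
    exact vec_eq_zero.2 ⟨h₀.symm, h₁.symm, h₂.symm, h₃.symm, h₄.symm⟩
  · replace h := h (.op (quo 1 0 0 0 0))
    simp [← MulOpposite.op_mul, quo_mul] at h
    refine ⟨vec (y.2.1.1 (.op (quo 0 1 0 0 0))) (y.2.2.1 (.op (quo 0 0 0 1 0)))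
      (y.1.1 (.op (quo 0 0 1 0 0))) (y.2.1.1 (.op (quo 0 0 1 0 0)))
      (y.2.2.1 (.op (quo 0 0 0 0 1))), Prod.ext ?_ (Prod.ext ?_ ?_)⟩
    all_goals refine Subtype.ext (LinearMap.ext (forall_op_quo.2 fun d₁ a d₂ b d₃ => ?_))
    · rw [toRightEnvelope_fst, Coinduced.apply_op_quo_of_middle _ d₁ a, h]
      simp [op_quo_smul_vec, coord_vec, mul_comm]
    · rw [toRightEnvelope_snd_fst, Coinduced.apply_op_quo_of_middle _ d₁ a]
      simp [op_quo_smul_vec, coord_vec, mul_comm, add_comm]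
    · rw [toRightEnvelope_snd_snd, Coinduced.apply_op_quo_of_last _ d₁ a]
      simp [op_quo_smul_vec, coord_vec, mul_comm, add_comm]
  · rintro ⟨c, rfl⟩
    revert c
    simp only [forall_vec, forall_op_quo, toRightEnvelope_fst, ← MulOpposite.op_mul, quo_mul,
      op_quo_smul_vec, coord_vec]
    simp
  · simp [op_quo_smul_vec, vec_eq_zero]

theorem isCotiltingBimodule :
    IsCotiltingBimodule K (upperTriangular K) (zeroRelation K) (CotiltingSpace K) :=
  ⟨bijective_toModuleEnd_left, bijective_toModuleEnd_right, isClassicalCotilting_left,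
    isClassicalCotilting_right⟩

end CotiltingSpace

end CotiltingSides

/-! ### The injective envelope -/

section Envelope

variable {K : Type} [Field K]

lemma Module.Injective.exists_smul_eq {A E : Type} [Ring A] [AddCommGroup E] [Module A E]
    (hE : Module.Injective A E) {w : A} {x : E} (h : ∀ a : A, a * w = 0 → a • x = 0) :
    ∃ y : E, w • y = x := by
  let f := LinearMap.toSpanSingleton A A w
  have hf : LinearMap.ker f ≤ LinearMap.ker (LinearMap.toSpanSingleton A E x) := h
  obtain ⟨k, hk⟩ := hE.out ((LinearMap.ker f).liftQ f le_rfl)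
    (LinearMap.ker_eq_bot.1 (Submodule.ker_liftQ_eq_bot _ _ _ le_rfl))
    ((LinearMap.ker f).liftQ _ hf)
  refine ⟨k 1, ?_⟩
  simpa [f, ← map_smul] using hk (Submodule.Quotient.mk 1)

namespace CotiltingSpace

/-- No bimodule structure over the algebra with zero relation extends to a left injective
envelope. -/
theorem not_hasRightExtension (E : Type) [AddCommGroup E] [Module (upperTriangular K) E]
    (j : CotiltingSpace K →ₗ[upperTriangular K] E)
    (hE : IsInjEnvelope (upperTriangular K) (CotiltingSpace K) E j) :
    ¬ HasRightExtension (upperTriangular K) (zeroRelation K) (CotiltingSpace K) E j := by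
  rintro ⟨m, hcomm, hjr⟩
  obtain ⟨hinj, hj, hess⟩ := hE
  rw [injective_iff_map_eq_zero] at hj
  obtain ⟨y, hy⟩ := hinj.exists_smul_eq (w := tri 0 0 1 0 0 0) (x := j (vec 1 0 0 0 0))
    (forall_tri.2 fun a b c d e f h => by
      simp [tri_mul, tri_eq_zero] at h
      simp [← map_smul, tri_smul_vec, h, ← zero_eq_vec])
  let α : (zeroRelation K)ᵐᵒᵖ := .op (quo 0 1 0 0 0)
  let β : (zeroRelation K)ᵐᵒᵖ := .op (quo 0 0 0 1 0)
  let ε : (zeroRelation K)ᵐᵒᵖ := .op (quo 0 0 1 0 0)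
  have hα : ε * α = α := by simp [α, ε, ← MulOpposite.op_mul, quo_mul]
  have hβ : β * α = 0 := by
    simp [α, β, ← MulOpposite.op_mul, quo_mul, quo_eq_zero]
  let p : CotiltingSpace K := vec 0 1 0 0 0
  let e : upperTriangular K := tri 0 0 0 0 0 1
  let z := e • (α • y - j p)
  have hez : e • z = z := by simp [z, e, smul_smul, tri_mul]
  have hεz : ε • z = z := by
    rw [← hcomm, smul_sub, smul_smul, hα, ← hjr]
    simp [p, ε, op_quo_smul_vec, z]
  have hwz : (tri 0 0 1 0 0 0 : upperTriangular K) • z = 0 := by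
    rw [smul_smul, smul_sub, ← map_smul]
    simp [e, tri_mul, hcomm, hy, ← hjr, α, op_quo_smul_vec, tri_smul_vec, p]
  have hz : ∀ a b c : K, ∀ M : upperTriangular K, (tri a b c 0 0 0 * M) • z = 0 := by
    refine fun a b c => forall_tri.2 fun a' b' c' d' e' f' => ?_
    rw [← hez, smul_smul]
    have : tri a b c 0 0 0 * tri a' b' c' d' e' f' * e =
        tri (a * c' + b * e' + c * f') 0 0 0 0 0 * tri 0 0 1 0 0 0 := by
      simp [e, tri_mul]
    rw [this, mul_smul, hwz, smul_zero]
  have hz₀ : z = 0 := by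
    by_contra hne
    obtain ⟨v, ⟨hv, c, rfl⟩, hv₀⟩ := (Submodule.ne_bot_iff _).1
      (hess (Submodule.span _ {z}) (by simpa using hne))
    obtain ⟨M, hM⟩ := Submodule.mem_span_singleton.1 hv
    have hc : ε • c = c := by
      refine sub_eq_zero.1 (hj _ ?_)
      rw [map_sub, hjr, ← hM, ← hcomm, hεz, sub_self]
    have hc' : ∀ a b d : K, tri a b d 0 0 0 • c = 0 := fun a b d => hj _ <| by
      rw [map_smul, ← hM, smul_smul, hz]
    obtain ⟨x₀, x₁, x₂, x₃, x₄, rfl⟩ := exists_eq_vec c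
    have h₁ := hc' 0 0 1
    have h₂ := hc' 0 1 0
    have h₃ := hc' 1 0 0
    simp [tri_smul_vec, vec_eq_zero, ε, op_quo_smul_vec, vec_inj] at hc h₁ h₂ h₃
    simp [← hc.1, ← hc.2, h₁, h₂, h₃, ← zero_eq_vec] at hv₀
  have h : β • z = - j (vec 0 0 0 0 1) := by
    rw [← hcomm, smul_sub, smul_smul, hβ, ← hjr, zero_smul, zero_sub, smul_neg, ← map_smul]
    simp [p, β, e, op_quo_smul_vec, tri_smul_vec]
  rw [hz₀, smul_zero, eq_comm, neg_eq_zero] at h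
  simpa [vec_eq_zero] using hj _ h

theorem isInjEnvelope_toEnvelope :
    IsInjEnvelope (upperTriangular K) (CotiltingSpace K) (Envelope K) (toEnvelope K) := by
  have h₁ := (Coinduced.isCoinduced (K := K) (e := (tri 1 0 0 0 0 0 : upperTriangular K))
    (by simp [tri_mul])).injective
  have h₃ := (Coinduced.isCoinduced (K := K) (e := (tri 0 0 0 0 0 1 : upperTriangular K))
    (by simp [tri_mul])).injective
  refine ⟨h₁.prod (h₁.prod h₃), toEnvelope_injective, fun N hN => ?_⟩
  obtain ⟨n, hn, hn₀⟩ := (Submodule.ne_bot_iff _).1 hN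
  rw [Submodule.ne_bot_iff]
  by_cases h : n.1 = 0
  · exact ⟨n, ⟨hn, (mem_range_toEnvelope n).1 fun M => by rw [h]; rfl⟩, hn₀⟩
  · obtain ⟨M, hM⟩ : ∃ M, n.1.1 M ≠ 0 := by
      by_contra! H
      exact h (Subtype.ext (LinearMap.ext H))
    refine ⟨_, ⟨N.smul_mem (tri 1 0 0 0 0 0 * M) hn, (mem_range_toEnvelope _).1 ?_⟩, ?_⟩
    · refine forall_tri.2 fun a b c d e f => ?_
      change n.1.1 (tri 0 1 0 0 0 0 * tri a b c d e f * (tri 1 0 0 0 0 0 * M)) = 0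
      rw [← mul_assoc, tri_mul, tri_mul]
      simp [← zero_eq_tri]
    · intro H
      have h' : n.1.1 (1 * (tri 1 0 0 0 0 0 * M)) = 0 := congrArg (fun y : Envelope K => y.1.1 1) H
      exact hM (by rwa [one_mul, n.1.2] at h')

variable (K) in
/-- The map dual to left multiplication by the path of length two. -/
def toSocle : Coinduced K (tri 1 0 0 0 0 0 : upperTriangular K) →ₗ[upperTriangular K]
    Coinduced K (tri 0 0 0 0 0 1 : upperTriangular K) :=
  Coinduced.map (u := tri 0 0 1 0 0 0) (by simp [tri_mul])

lemma forall_op_tri {p : (upperTriangular K)ᵐᵒᵖ → Prop} :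
    (∀ M, p M) ↔ ∀ a b c d e f, p (.op (tri a b c d e f)) := by
  refine ⟨fun h _ _ _ _ _ _ => h _, fun h M => ?_⟩
  obtain ⟨a, b, c, d, e, f, h'⟩ := exists_eq_tri M.unop
  rw [← M.op_unop, h']
  exact h ..

instance : SMul (upperTriangular K)ᵐᵒᵖ (Envelope K) where
  smul M y := (M.unop.1 0 0 • y.1, M.unop.1 0 1 • y.1 + M.unop.1 1 1 • y.2.1,
    M.unop.1 0 2 • toSocle K y.1 + M.unop.1 1 2 • toSocle K y.2.1 + M.unop.1 2 2 • y.2.2)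

lemma op_tri_smul (a b c d e f : K) (y : Envelope K) : MulOpposite.op (tri a b c d e f) • y =
    (a • y.1, b • y.1 + d • y.2.1, c • toSocle K y.1 + e • toSocle K y.2.1 + f • y.2.2) := rfl

instance : Module (upperTriangular K)ᵐᵒᵖ (Envelope K) where
  one_smul y := by
    rw [← MulOpposite.op_one, tri_one, op_tri_smul]
    simp
  mul_smul := by
    simp only [forall_op_tri, ← MulOpposite.op_mul, tri_mul, op_tri_smul, map_add,
      LinearMap.map_smul_of_tower]
    intros
    refine Prod.ext ?_ (Prod.ext ?_ ?_) <;> module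
  smul_zero := by
    simp only [forall_op_tri, op_tri_smul]
    simp
  smul_add := by
    simp only [forall_op_tri, op_tri_smul, Prod.fst_add, Prod.snd_add, map_add]
    intros
    refine Prod.ext ?_ (Prod.ext ?_ ?_) <;> dsimp only [Prod.fst_add, Prod.snd_add] <;> module
  add_smul := by
    simp only [forall_op_tri, ← MulOpposite.op_add, tri_add, op_tri_smul]
    intros
    refine Prod.ext ?_ (Prod.ext ?_ ?_) <;> dsimp only [Prod.fst_add, Prod.snd_add] <;> module
  zero_smul y := by
    rw [← MulOpposite.op_zero, zero_eq_tri, op_tri_smul]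
    simp

instance : SMulCommClass (upperTriangular K) (upperTriangular K)ᵐᵒᵖ (Envelope K) where
  smul_comm M := by
    simp only [forall_op_tri, op_tri_smul]
    intros
    simp [smul_comm M]

lemma toEnvelope_op_smul (M : upperTriangular K) (c : CotiltingSpace K) :
    toEnvelope K (MulOpposite.op (killPath K M) • c) = MulOpposite.op M • toEnvelope K c := by
  obtain ⟨m₀₀, m₀₁, m₀₂, m₁₁, m₁₂, m₂₂, rfl⟩ := exists_eq_tri M
  obtain ⟨x₀, x₁, x₂, x₃, x₄, rfl⟩ := exists_eq_vec c
  rw [killPath_tri, op_tri_smul, op_quo_smul_vec]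
  refine Prod.ext (Subtype.ext (LinearMap.ext fun N => ?_))
    (Prod.ext (Subtype.ext (LinearMap.ext fun N => ?_)) (Subtype.ext (LinearMap.ext fun N => ?_)))
  · change coord 0 (N • vec _ _ _ _ _) = m₀₀ * coord 0 (N • vec _ _ _ _ _)
    obtain ⟨a, b, c, d, e, f, rfl⟩ := exists_eq_tri N
    simp only [tri_smul_vec, coord_vec, Matrix.cons_val]
    ring
  · change coord 3 (N • vec _ _ _ _ _) =
      m₀₁ * coord 0 (N • vec _ _ _ _ _) + m₁₁ * coord 3 (N • vec _ _ _ _ _)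
    obtain ⟨a, b, c, d, e, f, rfl⟩ := exists_eq_tri N
    simp only [tri_smul_vec, coord_vec, Matrix.cons_val]
    ring
  · change coord 4 (N • vec _ _ _ _ _) =
      m₀₂ * coord 0 ((tri 0 0 1 0 0 0 * N) • vec _ _ _ _ _) +
        m₁₂ * coord 3 ((tri 0 0 1 0 0 0 * N) • vec _ _ _ _ _) + m₂₂ * coord 4 (N • vec _ _ _ _ _)
    obtain ⟨a, b, c, d, e, f, rfl⟩ := exists_eq_tri N
    simp only [tri_smul_vec, tri_mul, coord_vec, Matrix.cons_val]
    ring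

end CotiltingSpace

end Envelope

/-- There exist a finite-dimensional cotilting `S`-`R`-bimodule `C` whose
left injective envelope admits no compatible `S`-`R`-bimodule structure containing `C`,
together with a hereditary finite-dimensional algebra `R*`, a surjective algebra map
`F : R* → R` with `1`-dimensional kernel, and an `S`-`R*`-bimodule `U` containing `C`
(restricted along `F`) whose underlying left `S`-module is an injective envelope of `C`. -/
theorem hereditary_concealed_ring_exists : Nonempty HereditaryConcealedExample := by
  exact ⟨{
    K := ℚ
    S := upperTriangular ℚ
    finS := inferInstance
    R := zeroRelation ℚ
    finR := inferInstance
    C := CotiltingSpace ℚ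
    finC := inferInstance
    cotilting := CotiltingSpace.isCotiltingBimodule
    noLeftExt := CotiltingSpace.not_hasRightExtension
    Rstar := upperTriangular ℚ
    finRstar := inferInstance
    F := killPath ℚ
    surjF := killPath_surjective
    hered := isLeftHereditary_upperTriangular
    kerF_dim := finrank_ker_killPath
    U := CotiltingSpace.Envelope ℚ
    j := CotiltingSpace.toEnvelope ℚ
    envU := CotiltingSpace.isInjEnvelope_toEnvelope
    j_right_linear := CotiltingSpace.toEnvelope_op_smul }⟩
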